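/- Let (X, b, s) be a b-metric space with coefficient s ≥ 1 and let S : X → X. Suppose there exist an A_R-simulation function J whose sequence condition holds with the same coefficient s (with associated F ∈ 𝔉_c having constant c ≥ 1 and ϑ ∈ Θ*) such that for all x, y ∈ X with Sx ≠ Sy, J(ϑ(b(Sx,Sy)), ϑ(max{b(x,y), b(x,Sx), b(y,Sy), (b(Sx,y) + b(x,Sy))/(2s)})) ≥ c. Let a_0 ∈ X, set a_n = S^n a_0, and assume r_n := b(a_n, a_{n+1}) > 0 for all n ≥ 0. Then (r_n) is a decreasing sequence and lim_{n→∞} r_n = 0. -/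

import Mathlib

open Filter Topology

/-- A b-metric on `X` with coefficient `s`. -/
def IsBMetric {X : Type*} (b : X → X → ℝ) (s : ℝ) : Prop :=
  (∀ x y, 0 ≤ b x y) ∧
  (∀ x y, b x y = 0 ↔ x = y) ∧
  (∀ x y, b x y = b y x) ∧
  (∀ x y z, b x z ≤ s * (b x y + b y z))

/-- A sequence is Cauchy with respect to a b-metric. -/
def BCauchy {X : Type*} (b : X → X → ℝ) (u : ℕ → X) : Prop :=
  ∀ ε > (0 : ℝ), ∃ N : ℕ, ∀ k ≥ N, ∀ m ≥ N, b (u k) (u m) < ε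

/-- Completeness of a b-metric space: every Cauchy sequence converges. -/
def BComplete {X : Type*} (b : X → X → ℝ) : Prop :=
  ∀ u : ℕ → X, BCauchy b u → ∃ z : X, Tendsto (fun n => b (u n) z) atTop (𝓝 0)

/-- `S` is b-continuous: it preserves convergence of sequences. -/
def BContinuousMap {X : Type*} (b : X → X → ℝ) (S : X → X) : Prop :=
  ∀ (u : ℕ → X) (x : X), Tendsto (fun n => b (u n) x) atTop (𝓝 0) →
    Tendsto (fun n => b (S (u n)) (S x)) atTop (𝓝 0)

/-- The class `Θ*` of auxiliary functions `ϑ : (0,∞) → (1,∞)`: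
increasing, continuous, and `ϑ(aₙ) → 1` iff `aₙ → 0`. -/
def ThetaStar (ϑ : ℝ → ℝ) : Prop :=
  (∀ x, 0 < x → 1 < ϑ x) ∧
  MonotoneOn ϑ (Set.Ioi 0) ∧
  ContinuousOn ϑ (Set.Ioi 0) ∧
  ∀ u : ℕ → ℝ, (∀ n, 0 < u n) →
    (Tendsto (fun n => ϑ (u n)) atTop (𝓝 1) ↔ Tendsto u atTop (𝓝 0))

/-- The class `𝔉_c` of functions `F : [1,∞) × [1,∞) → ℝ` with constant `c ≥ 1`. -/
def FcClass (F : ℝ → ℝ → ℝ) (c : ℝ) : Prop :=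
  ContinuousOn (fun p : ℝ × ℝ => F p.1 p.2) (Set.Ici 1 ×ˢ Set.Ici 1) ∧
  (∀ x y, 1 ≤ x → 1 ≤ y → F x y ≤ x) ∧
  (∀ x y, 1 ≤ x → 1 ≤ y → F x y = x → x = 1 ∨ y = 1) ∧
  1 ≤ c ∧
  (∀ x y, 1 ≤ x → 1 ≤ y → c < F x y → y < x) ∧
  (∀ x, 1 ≤ x → F x x ≤ c)

/-- The condition on a pair of positive sequences appearing in the definition of an
`A_R`-simulation function with coefficient `s`:
`0 < liminf uₙ ≤ s·limsup vₙ ≤ s²·liminf uₙ < ∞` and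
`0 < liminf vₙ ≤ s·limsup uₙ ≤ s²·liminf vₙ < ∞` (computed in the extended reals). -/
def SeqCond (s : ℝ) (u v : ℕ → ℝ) : Prop :=
  (0 < Filter.liminf (fun n => ((u n : EReal))) atTop ∧
    Filter.liminf (fun n => ((u n : EReal))) atTop ≤
      (s : EReal) * Filter.limsup (fun n => ((v n : EReal))) atTop ∧
    (s : EReal) * Filter.limsup (fun n => ((v n : EReal))) atTop ≤
      ((s ^ 2 : ℝ) : EReal) * Filter.liminf (fun n => ((u n : EReal))) atTop ∧
    ((s ^ 2 : ℝ) : EReal) * Filter.liminf (fun n => ((u n : EReal))) atTop < ⊤) ∧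
  (0 < Filter.liminf (fun n => ((v n : EReal))) atTop ∧
    Filter.liminf (fun n => ((v n : EReal))) atTop ≤
      (s : EReal) * Filter.limsup (fun n => ((u n : EReal))) atTop ∧
    (s : EReal) * Filter.limsup (fun n => ((u n : EReal))) atTop ≤
      ((s ^ 2 : ℝ) : EReal) * Filter.liminf (fun n => ((v n : EReal))) atTop ∧
    ((s ^ 2 : ℝ) : EReal) * Filter.liminf (fun n => ((v n : EReal))) atTop < ⊤)

/-- `J` is an `A_R`-simulation function with data `s`, `F ∈ 𝔉_c` (constant `c`), `ϑ ∈ Θ*`. -/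
def ARSimulation (J : ℝ → ℝ → ℝ) (s : ℝ) (F : ℝ → ℝ → ℝ) (c : ℝ) (ϑ : ℝ → ℝ) : Prop :=
  (∀ x y : ℝ, 1 < x → 1 < y → J x y < F y x) ∧
  ∀ u v : ℕ → ℝ, (∀ n, 0 < u n) → (∀ n, 0 < v n) → SeqCond s u v →
    Filter.limsup (fun n => J (ϑ (u n)) (ϑ (v n))) atTop < c

/-- Two positive sequences with a common positive limit satisfy `SeqCond`. -/
theorem SeqCond.of_tendsto {s L : ℝ} (hs : 1 ≤ s) (hL : 0 < L) {u v : ℕ → ℝ}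
    (hu : Tendsto u atTop (𝓝 L)) (hv : Tendsto v atTop (𝓝 L)) : SeqCond s u v := by
  have key : ∀ {w : ℕ → ℝ}, Tendsto w atTop (𝓝 L) →
      Tendsto (fun n => (w n : EReal)) atTop (𝓝 (L : EReal)) := fun hw =>
    (continuous_coe_real_ereal.tendsto L).comp hw
  have h1 : L ≤ s * L := le_mul_of_one_le_left hL.le hs
  have h2 : s * L ≤ s ^ 2 * L := by nlinarith
  unfold SeqCond
  rw [(key hu).liminf_eq, (key hu).limsup_eq, (key hv).liminf_eq, (key hv).limsup_eq,
    ← EReal.coe_mul, ← EReal.coe_mul]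
  have h : (0 : EReal) < (L : EReal) ∧ (L : EReal) ≤ ((s * L : ℝ) : EReal) ∧
      ((s * L : ℝ) : EReal) ≤ ((s ^ 2 * L : ℝ) : EReal) ∧
      ((s ^ 2 * L : ℝ) : EReal) < ⊤ :=
    ⟨EReal.coe_pos.2 hL, EReal.coe_le_coe_iff.2 h1, EReal.coe_le_coe_iff.2 h2,
      EReal.coe_lt_top _⟩
  exact ⟨h, h⟩

/-- The values `c ≤ J (ϑ x) (ϑ y)` of a simulation function force `x < y`. -/
theorem ARSimulation.lt_of_le {J F : ℝ → ℝ → ℝ} {s c : ℝ} {ϑ : ℝ → ℝ}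
    (hJ : ARSimulation J s F c ϑ) (hϑ : ThetaStar ϑ) (hF : FcClass F c) {x y : ℝ}
    (hx : 0 < x) (hy : 0 < y) (h : c ≤ J (ϑ x) (ϑ y)) : x < y := by
  have hϑx := hϑ.1 x hx
  have hϑy := hϑ.1 y hy
  have hlt := hF.2.2.2.2.1 _ _ hϑy.le hϑx.le (h.trans_lt (hJ.1 _ _ hϑx hϑy))
  by_contra! hyx
  exact (hϑ.2.1 hy hx hyx).not_gt hlt

/-- A positive decreasing sequence with `c ≤ J (ϑ (r (n + 1))) (ϑ (r n))` tends to `0`. -/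
theorem ARSimulation.tendsto_zero {J F : ℝ → ℝ → ℝ} {s c : ℝ} {ϑ : ℝ → ℝ} (hs : 1 ≤ s)
    (hJ : ARSimulation J s F c ϑ) (hϑ : ThetaStar ϑ) (hF : FcClass F c) {r : ℕ → ℝ}
    (hr : ∀ n, 0 < r n) (hanti : Antitone r)
    (h : ∀ n, c ≤ J (ϑ (r (n + 1))) (ϑ (r n))) : Tendsto r atTop (𝓝 0) := by
  have hbdd : BddBelow (Set.range r) := ⟨0, by rintro _ ⟨n, rfl⟩; exact (hr n).le⟩
  have hlim := tendsto_atTop_ciInf hanti hbdd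
  rcases (le_ciInf fun n => (hr n).le : 0 ≤ ⨅ n, r n).eq_or_lt with h0 | hL
  · rwa [← h0] at hlim
  have hlt := hJ.2 (fun n => r (n + 1)) r (fun n => hr _) hr
    (SeqCond.of_tendsto hs hL (hlim.comp (tendsto_add_atTop_nat 1)) hlim)
  have hub : ∀ n, J (ϑ (r (n + 1))) (ϑ (r n)) ≤ ϑ (r 0) := fun n =>
    ((hJ.1 _ _ (hϑ.1 _ (hr _)) (hϑ.1 _ (hr _))).le.trans
      (hF.2.1 _ _ (hϑ.1 _ (hr _)).le (hϑ.1 _ (hr _)).le)).trans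
      (hϑ.2.1 (hr n) (hr 0) (hanti n.zero_le))
  have hle : c ≤ limsup (fun n => J (ϑ (r (n + 1))) (ϑ (r n))) atTop :=
    le_limsup_of_frequently_le (Frequently.of_forall h)
      (isBoundedUnder_of ⟨_, hub⟩)
  exact absurd hlt hle.not_gt

/-- For a generalized `𝔍_{A_R}`-contraction, the Picard distances are strictly
decreasing and tend to `0`. -/
theorem picard_distances_decreasing_generalized {X : Type*} [Nonempty X]
    (b : X → X → ℝ) (s : ℝ) (hs : 1 ≤ s)
    (hb : IsBMetric b s) (S : X → X)
    (J F : ℝ → ℝ → ℝ) (ϑ : ℝ → ℝ) (c : ℝ)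
    (hϑ : ThetaStar ϑ) (hF : FcClass F c)
    (hJ : ARSimulation J s F c ϑ)
    (hcontr : ∀ x y : X, S x ≠ S y →
      c ≤ J (ϑ (b (S x) (S y)))
            (ϑ (max (max (b x y) (b x (S x)))
                (max (b y (S y)) ((b (S x) y + b x (S y)) / (2 * s))))))
    (a₀ : X) (hpos : ∀ n : ℕ, 0 < b (S^[n] a₀) (S^[n + 1] a₀)) :
    StrictAnti (fun n : ℕ => b (S^[n] a₀) (S^[n + 1] a₀)) ∧
      Tendsto (fun n : ℕ => b (S^[n] a₀) (S^[n + 1] a₀)) atTop (𝓝 0) := by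
  obtain ⟨-, hb0, -, hbtri⟩ := hb
  set r : ℕ → ℝ := fun n => b (S^[n] a₀) (S^[n + 1] a₀) with hr
  have hmax : ∀ n, c ≤ J (ϑ (r (n + 1))) (ϑ (max (r n) (r (n + 1)))) := by
    intro n
    have hne : S (S^[n] a₀) ≠ S (S^[n + 1] a₀) := by
      rw [← Function.iterate_succ_apply' S, ← Function.iterate_succ_apply' S, Ne, ← hb0]
      exact (hpos (n + 1)).ne'
    have h := hcontr _ _ hne
    rw [← Function.iterate_succ_apply' S, ← Function.iterate_succ_apply' S,
      (hb0 (S^[n + 1] a₀) _).2 rfl, zero_add, max_self] at h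
    have hmid : b (S^[n] a₀) (S^[n + 1 + 1] a₀) / (2 * s) ≤ max (r n) (r (n + 1)) := by
      rw [div_le_iff₀ (by positivity)]
      have htri : b (S^[n] a₀) (S^[n + 1 + 1] a₀) ≤ s * (r n + r (n + 1)) := hbtri _ _ _
      have h1 := le_max_left (r n) (r (n + 1))
      have h2 := le_max_right (r n) (r (n + 1))
      nlinarith
    rwa [← max_assoc, max_eq_left hmid] at h
  have hlt : ∀ n, r (n + 1) < r n := fun n =>
    (lt_max_iff.1 (hJ.lt_of_le hϑ hF (hpos (n + 1)) (lt_max_of_lt_left (hpos n))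
      (hmax n))).resolve_right (lt_irrefl _)
  have hanti : StrictAnti r := strictAnti_nat_of_succ_lt hlt
  refine ⟨hanti, hJ.tendsto_zero hs hϑ hF hpos hanti.antitone fun n => ?_⟩
  simpa only [max_eq_left (hlt n).le] using hmax n
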